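/- arXiv:1807.10618 — 5 statements merged into one kernel-verified Lean document; each statement's English description precedes it below -/
import Mathlib

section
/- For every β ∈ ℝ^k with R_E β = r_E, the componentwise strict inequality R_I β > r_I holds if and only if R̃_I (D β) > r̃_I holds componentwise, where R̃_I = R_I D⁺ and r̃_I = r_I − R_I R_E⁺ r_E. -/
open Matrix

/-- The Gram matrix of the rows of a real matrix of full row rank is invertible. -/
theorem isUnit_det_mul_transpose_of_rank_eq {m n : ℕ} (A : Matrix (Fin m) (Fin n) ℝ)
    (hA : A.rank = m) : IsUnit (A * Aᵀ).det := by
  rw [← Matrix.isUnit_iff_isUnit_det, ← Matrix.linearIndependent_rows_iff_isUnit,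
    linearIndependent_iff_card_eq_finrank_span, Set.finrank,
    ← Matrix.rank_eq_finrank_span_row, Matrix.rank_self_mul_transpose, hA, Fintype.card_fin]

/-- If the rows of two full-row-rank matrices span orthogonal complements, the projections onto
the two row spaces sum to the identity. -/
theorem pinv_mul_self_add_pinv_mul_self_eq_one {k q : ℕ} (hq : q ≤ k)
    (R : Matrix (Fin q) (Fin k) ℝ) (D : Matrix (Fin (k - q)) (Fin k) ℝ)
    (hR : R.rank = q) (hD : D.rank = k - q) (hDR : D * Rᵀ = 0) :
    Rᵀ * (R * Rᵀ)⁻¹ * R + Dᵀ * (D * Dᵀ)⁻¹ * D = 1 := by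
  have hRD : R * Dᵀ = 0 := by
    simpa using congrArg Matrix.transpose hDR
  have h : fromRows R D * fromCols (Rᵀ * (R * Rᵀ)⁻¹) (Dᵀ * (D * Dᵀ)⁻¹) = 1 := by
    rw [fromRows_mul_fromCols, ← Matrix.mul_assoc, ← Matrix.mul_assoc, ← Matrix.mul_assoc,
      ← Matrix.mul_assoc, hRD, hDR,
      Matrix.mul_nonsing_inv _ (isUnit_det_mul_transpose_of_rank_eq R hR),
      Matrix.mul_nonsing_inv _ (isUnit_det_mul_transpose_of_rank_eq D hD),
      Matrix.zero_mul, Matrix.zero_mul, fromBlocks_one]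
  rw [← fromCols_mul_fromRows]
  exact (Matrix.mul_eq_one_comm_of_card_eq _ _ _ (by simp; omega)).1 h

/-- For every `β ∈ ℝ^k` with `R_E β = r_E`, the componentwise strict
inequality `R_I β > r_I` holds iff `R̃_I (D β) > r̃_I` holds componentwise, where
`R̃_I = R_I D⁺` and `r̃_I = r_I − R_I R_E⁺ r_E`. -/
theorem stmt_3 {k qE qI : ℕ} (hq : qE ≤ k)
    (RE : Matrix (Fin qE) (Fin k) ℝ) (D : Matrix (Fin (k - qE)) (Fin k) ℝ)
    (RI : Matrix (Fin qI) (Fin k) ℝ) (rE : Fin qE → ℝ) (rI : Fin qI → ℝ)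
    (hRE : RE.rank = qE) (hD : D.rank = k - qE)
    (hDRE : D * REᵀ = 0)
    (β : Fin k → ℝ) (hβ : RE.mulVec β = rE) :
    (∀ i, rI i < (RI.mulVec β) i) ↔
      (∀ i, (rI - (RI * (REᵀ * (RE * REᵀ)⁻¹)).mulVec rE) i <
        ((RI * (Dᵀ * (D * Dᵀ)⁻¹)).mulVec (D.mulVec β)) i) := by
  have key : RI.mulVec β = (RI * (REᵀ * (RE * REᵀ)⁻¹)).mulVec rE +
      (RI * (Dᵀ * (D * Dᵀ)⁻¹)).mulVec (D.mulVec β) := by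
    rw [← hβ, Matrix.mulVec_mulVec, Matrix.mulVec_mulVec, ← Matrix.add_mulVec,
      Matrix.mul_assoc RI, Matrix.mul_assoc RI, ← Matrix.mul_add,
      pinv_mul_self_add_pinv_mul_self_eq_one hq RE D hRE hD hDRE, Matrix.mul_one]
  refine forall_congr' fun i => ?_
  rw [key, Pi.add_apply, Pi.sub_apply, sub_lt_iff_lt_add']
end

section
/- For any real b with 0 < b ≤ 1 and nb > k, the normalized fractional marginal posterior density of β is a multivariate Student t density: for every β ∈ ℝ^k, [∫₀^∞ (2πσ²)^{−nb/2} exp(−b‖y − Xβ‖²/(2σ²)) (σ²)⁻¹ dσ²] / [∫_{ℝ^k} ∫₀^∞ (2πσ²)^{−nb/2} exp(−b‖y − Xβ'‖²/(2σ²)) (σ²)⁻¹ dσ² dβ'] = t(β; β̂, s²(nb−k)⁻¹(XᵀX)⁻¹, nb−k). -/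
open Matrix MeasureTheory

/-- The multivariate Student `t` density. -/
noncomputable def studentT {d : ℕ} (ν : ℝ) (m : Fin d → ℝ)
    (S : Matrix (Fin d) (Fin d) ℝ) (x : Fin d → ℝ) : ℝ :=
  Real.Gamma ((ν + d) / 2) /
      (Real.Gamma (ν / 2) * (ν * Real.pi) ^ ((d : ℝ) / 2) * Real.sqrt S.det) *
    (1 + (x - m) ⬝ᵥ S⁻¹.mulVec (x - m) / ν) ^ (-(ν + d) / 2)

section Gaussian

open scoped MatrixOrder

variable {ι : Type*} [Fintype ι]

theorem integrable_exp_neg_mul_dotProduct_self {u : ℝ} (hu : 0 < u) :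
    Integrable (fun v : ι → ℝ => Real.exp (-u * (v ⬝ᵥ v))) := by
  have h := Integrable.fintype_prod (ι := ι) (f := fun _ (x : ℝ) => Real.exp (-u * x ^ 2))
    (μ := fun _ => volume) fun _ => integrable_exp_neg_mul_sq hu
  refine h.congr (.of_forall fun v => ?_)
  simp only [dotProduct, Finset.mul_sum, Real.exp_sum, pow_two]

theorem integral_exp_neg_mul_dotProduct_self {u : ℝ} (hu : 0 < u) :
    ∫ v : ι → ℝ, Real.exp (-u * (v ⬝ᵥ v)) = (Real.pi / u) ^ ((Fintype.card ι : ℝ) / 2) := by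
  have h := integral_fintype_prod_volume_eq_pow (ι := ι) fun x : ℝ => Real.exp (-u * x ^ 2)
  rw [integral_gaussian, Real.sqrt_eq_rpow, ← Real.rpow_mul_natCast (by positivity)] at h
  rw [one_div_mul_eq_div] at h
  rw [← h]
  simp only [dotProduct, Finset.mul_sum, Real.exp_sum, pow_two]

variable [DecidableEq ι]

theorem Matrix.PosDef.exists_dotProduct_mulVec_eq {A : Matrix ι ι ℝ} (hA : A.PosDef) :
    ∃ B : Matrix ι ι ℝ, B.det = √A.det ∧ ∀ v, v ⬝ᵥ A *ᵥ v = (B *ᵥ v) ⬝ᵥ (B *ᵥ v) := by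
  have hS : (CFC.sqrt A)ᵀ = CFC.sqrt A := by
    have := (nonneg_iff_posSemidef.mp (CFC.sqrt_nonneg A)).isHermitian
    simpa [IsHermitian, conjTranspose_eq_transpose_of_trivial] using this
  refine ⟨CFC.sqrt A, by simpa using hA.posSemidef.det_sqrt, fun v => ?_⟩
  nth_rewrite 1 [← CFC.sqrt_mul_sqrt_self A (nonneg_iff_posSemidef.mpr hA.posSemidef)]
  rw [← mulVec_mulVec, dotProduct_mulVec, ← mulVec_transpose, hS]

theorem Matrix.PosDef.integrable_and_integral_exp_neg_mul {A : Matrix ι ι ℝ} (hA : A.PosDef)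
    {u : ℝ} (hu : 0 < u) :
    Integrable (fun v : ι → ℝ => Real.exp (-u * (v ⬝ᵥ A *ᵥ v))) ∧
      ∫ v : ι → ℝ, Real.exp (-u * (v ⬝ᵥ A *ᵥ v)) =
        (Real.pi / u) ^ ((Fintype.card ι : ℝ) / 2) / √A.det := by
  obtain ⟨B, hB, h⟩ := hA.exists_dotProduct_mulVec_eq
  have hpos : 0 < B.det := hB ▸ Real.sqrt_pos.mpr hA.det_pos
  have hmap := Real.map_matrix_volume_pi_eq_smul_volume_pi hpos.ne'
  have hmeas : Measurable (toLin' B) := (LinearMap.continuous_on_pi _).measurable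
  have hint := integrable_exp_neg_mul_dotProduct_self (ι := ι) hu
  have hint' : Integrable (fun v : ι → ℝ => Real.exp (-u * (v ⬝ᵥ v)))
      (Measure.map (toLin' B) volume) := by
    rw [hmap]
    exact hint.smul_measure ENNReal.ofReal_ne_top
  simp only [h]
  refine ⟨hint'.comp_measurable hmeas, ?_⟩
  have := integral_map hmeas.aemeasurable hint'.aestronglyMeasurable
  simp only [toLin'_apply] at this
  rw [← this, hmap, integral_smul_measure, integral_exp_neg_mul_dotProduct_self hu, ← hB,
    ENNReal.toReal_ofReal (abs_nonneg _), abs_of_pos (inv_pos.mpr hpos), smul_eq_mul,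
    div_eq_inv_mul _ B.det]

end Gaussian

theorem integral_rpow_mul_exp_neg_div_mul_inv {a c : ℝ} (ha : 0 < a) (hc : 0 < c) :
    ∫ t in Set.Ioi (0 : ℝ), (2 * Real.pi * t) ^ (-a) * Real.exp (-c / t) * t⁻¹ =
      (2 * Real.pi) ^ (-a) * Real.Gamma a * c ^ (-a) := by
  have h := integral_comp_rpow_Ioi (fun u : ℝ => u ^ (a - 1) * Real.exp (-(c * u)))
    (p := -1) (by norm_num)
  rw [Real.integral_rpow_mul_exp_neg_mul_Ioi ha hc] at h
  rw [Real.rpow_neg hc.le, ← Real.inv_rpow hc.le, ← one_div, mul_assoc,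
    mul_comm (Real.Gamma a), ← h, ← integral_const_mul]
  refine setIntegral_congr_fun measurableSet_Ioi fun t (ht : 0 < t) => ?_
  have ht' : t ^ (-1 - 1 : ℝ) * t ^ (1 - a) = t ^ (-a) * t⁻¹ := by
    rw [← Real.rpow_neg_one t, ← Real.rpow_add ht, ← Real.rpow_add ht]
    ring_nf
  have ht'' : (t ^ (-1 : ℝ)) ^ (a - 1) = t ^ (1 - a) := by
    rw [← Real.rpow_mul ht.le]; ring_nf
  simp only [smul_eq_mul, ht'']
  rw [Real.mul_rpow (by positivity) ht.le, Real.rpow_neg_one t, abs_neg, abs_one, one_mul,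
    ← mul_assoc (t ^ (-1 - 1 : ℝ)), ht', ← div_eq_mul_inv c, neg_div]
  ring

theorem Matrix.PosDef.integral_const_add_rpow_neg {ι : Type*} [Fintype ι] [DecidableEq ι]
    {A : Matrix ι ι ℝ} (hA : A.PosDef) {a s : ℝ} (hs : 0 < s)
    (ha : (Fintype.card ι : ℝ) / 2 < a) :
    ∫ v : ι → ℝ, (s + v ⬝ᵥ A *ᵥ v) ^ (-a) =
      Real.pi ^ ((Fintype.card ι : ℝ) / 2) * Real.Gamma (a - Fintype.card ι / 2) *
        s ^ (-(a - Fintype.card ι / 2)) / (Real.Gamma a * √A.det) := by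
  set d : ℝ := (Fintype.card ι : ℝ) / 2 with hd
  have hd0 : 0 ≤ d := by positivity
  have ha0 : 0 < a := hd0.trans_lt ha
  have hQ (v : ι → ℝ) : 0 ≤ v ⬝ᵥ A *ᵥ v := by simpa using hA.posSemidef.dotProduct_mulVec_nonneg v
  set F : (ι → ℝ) → ℝ → ℝ := fun v u =>
    u ^ (a - 1) * Real.exp (-(s * u)) * Real.exp (-u * (v ⬝ᵥ A *ᵥ v)) with hF
  have hFu (v : ι → ℝ) : ∫ u in Set.Ioi (0 : ℝ), F v u = Real.Gamma a * (s + v ⬝ᵥ A *ᵥ v) ^ (-a) := by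
    have hpos : 0 < s + v ⬝ᵥ A *ᵥ v := by linarith [hQ v]
    rw [Real.rpow_neg hpos.le, ← Real.inv_rpow hpos.le, ← one_div, mul_comm,
      ← Real.integral_rpow_mul_exp_neg_mul_Ioi ha0 hpos]
    refine integral_congr_ae (.of_forall fun u => ?_)
    simp only [hF, mul_assoc, ← Real.exp_add]
    ring_nf
  have hFv (u : ℝ) (hu : 0 < u) : ∫ v : ι → ℝ, F v u =
      Real.pi ^ d / √A.det * (u ^ (a - d - 1) * Real.exp (-(s * u))) := by
    simp only [hF]
    rw [integral_const_mul, (hA.integrable_and_integral_exp_neg_mul hu).2,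
      ← hd, Real.div_rpow Real.pi_pos.le hu.le, show a - d - 1 = (a - 1) - d by ring,
      Real.rpow_sub hu (a - 1)]
    ring
  have hint : Integrable (Function.uncurry F)
      ((volume : Measure (ι → ℝ)).prod (volume.restrict (Set.Ioi (0 : ℝ)))) := by
    have hmeas : Measurable (Function.uncurry F) := by
      simp only [hF, Function.uncurry_def, dotProduct, mulVec]
      fun_prop
    refine (integrable_prod_iff' hmeas.aestronglyMeasurable).mpr ⟨?_, ?_⟩
    · filter_upwards [ae_restrict_mem measurableSet_Ioi] with u hu
      exact (hA.integrable_and_integral_exp_neg_mul hu).1.const_mul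
        (u ^ (a - 1) * Real.exp (-(s * u)))
    · have h := integrableOn_rpow_mul_exp_neg_mul_rpow (s := a - d - 1) (p := 1) (b := s)
        (by linarith) one_pos hs
      refine (h.const_mul (Real.pi ^ d / √A.det)).congr ?_
      filter_upwards [ae_restrict_mem measurableSet_Ioi] with u hu
      have hu : 0 < u := hu
      rw [Real.rpow_one, neg_mul, ← hFv u hu]
      refine integral_congr_ae (.of_forall fun v => ?_)
      simp only [Function.uncurry_apply_pair]
      rw [Real.norm_of_nonneg]
      simp only [hF]
      positivity
  have hswap := integral_integral_swap hint
  simp only [hFu] at hswap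
  rw [integral_const_mul, setIntegral_congr_fun measurableSet_Ioi hFv, integral_const_mul,
    Real.integral_rpow_mul_exp_neg_mul_Ioi (sub_pos.mpr ha) hs, one_div, Real.inv_rpow hs.le,
    ← Real.rpow_neg hs.le] at hswap
  have hG := (Real.Gamma_pos_of_pos ha0).ne'
  rw [← mul_right_inj' hG, hswap]
  field_simp

theorem Matrix.sub_mulVec_dotProduct_self_eq {m ι : Type*} [Fintype m] [Fintype ι] [DecidableEq ι]
    {X : Matrix m ι ℝ} (hX : IsUnit (Xᵀ * X)) (y : m → ℝ) (β : ι → ℝ) {βhat : ι → ℝ}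
    (hβ : βhat = (Xᵀ * X)⁻¹ *ᵥ (Xᵀ *ᵥ y)) :
    (y - X *ᵥ β) ⬝ᵥ (y - X *ᵥ β) = (y - X *ᵥ βhat) ⬝ᵥ (y - X *ᵥ βhat) +
      (β - βhat) ⬝ᵥ (Xᵀ * X) *ᵥ (β - βhat) := by
  have hdet : IsUnit (Xᵀ * X).det := (isUnit_iff_isUnit_det _).mp hX
  have hr : Xᵀ *ᵥ (y - X *ᵥ βhat) = 0 := by
    rw [mulVec_sub, mulVec_mulVec, hβ, mulVec_mulVec, mul_nonsing_inv _ hdet, one_mulVec, sub_self]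
  have horth (w : ι → ℝ) : (y - X *ᵥ βhat) ⬝ᵥ X *ᵥ w = 0 := by
    rw [dotProduct_mulVec, ← mulVec_transpose, hr, zero_dotProduct]
  have hsplit : y - X *ᵥ β = (y - X *ᵥ βhat) - X *ᵥ (β - βhat) := by
    rw [mulVec_sub]; abel
  have hquad (w : ι → ℝ) : w ⬝ᵥ (Xᵀ * X) *ᵥ w = X *ᵥ w ⬝ᵥ X *ᵥ w := by
    rw [← mulVec_mulVec, dotProduct_mulVec, ← mulVec_transpose, transpose_transpose]
  rw [hsplit, sub_dotProduct _ (X *ᵥ _), dotProduct_sub _ _ (X *ᵥ (β - βhat)),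
    dotProduct_sub _ _ (X *ᵥ (β - βhat)), horth,
    dotProduct_comm (X *ᵥ _) (y - _), horth, hquad]
  ring

theorem Matrix.posDef_transpose_mul_self_of_isUnit {m ι : Type*} [Fintype m] [Fintype ι]
    [DecidableEq ι] {X : Matrix m ι ℝ} (hX : IsUnit (Xᵀ * X)) : (Xᵀ * X).PosDef := by
  have h : (Xᵀ * X).PosSemidef := by
    simpa [conjTranspose_eq_transpose_of_trivial] using posSemidef_conjTranspose_mul_self X
  exact h.posDef_iff_isUnit.mpr hX

theorem studentT_eq {d : ℕ} {A : Matrix (Fin d) (Fin d) ℝ} (hA : A.PosDef) {ν s : ℝ} (hν : 0 < ν)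
    (hs : 0 < s) (m x : Fin d → ℝ) :
    studentT ν m ((s / ν) • A⁻¹) x =
      Real.Gamma ((ν + d) / 2) * √A.det * s ^ (ν / 2) /
        (Real.Gamma (ν / 2) * Real.pi ^ ((d : ℝ) / 2)) *
        (s + (x - m) ⬝ᵥ A *ᵥ (x - m)) ^ (-((ν + d) / 2)) := by
  have hdet := hA.det_pos
  have hQ : 0 ≤ (x - m) ⬝ᵥ A *ᵥ (x - m) := by
    simpa using hA.posSemidef.dotProduct_mulVec_nonneg (x - m)
  have hsν : 0 < s / ν := div_pos hs hν
  have hinv : ((s / ν) • A⁻¹)⁻¹ = (ν / s) • A := by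
    refine inv_eq_left_inv ?_
    rw [smul_mul_smul_comm, mul_nonsing_inv _ hdet.ne'.isUnit, div_mul_div_cancel₀ hs.ne',
      div_self hν.ne', one_smul]
  have hsqrt : √((s / ν) • A⁻¹).det = (s / ν) ^ ((d : ℝ) / 2) / √A.det := by
    rw [det_smul, Fintype.card_fin, det_nonsing_inv, Ring.inverse_eq_inv',
      Real.sqrt_mul (by positivity), Real.sqrt_inv, Real.sqrt_eq_rpow, ← Real.rpow_natCast_mul hsν.le,
      mul_one_div, div_eq_mul_inv _ (√A.det)]
  have hbase : 1 + (x - m) ⬝ᵥ ((s / ν) • A⁻¹)⁻¹ *ᵥ (x - m) / ν =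
      (s + (x - m) ⬝ᵥ A *ᵥ (x - m)) / s := by
    rw [hinv, smul_mulVec, dotProduct_smul, smul_eq_mul]
    field_simp
  have hscale : (ν * Real.pi) ^ ((d : ℝ) / 2) * (s / ν) ^ ((d : ℝ) / 2) =
      Real.pi ^ ((d : ℝ) / 2) * s ^ ((d : ℝ) / 2) := by
    rw [← Real.mul_rpow (by positivity) hsν.le, ← Real.mul_rpow (by positivity) hs.le]
    congr 1
    field_simp
  have hpow : s ^ ((ν + d) / 2) = s ^ (ν / 2) * s ^ ((d : ℝ) / 2) := by
    rw [← Real.rpow_add hs]; ring_nf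
  have hΓ := (Real.Gamma_pos_of_pos (half_pos hν)).ne'
  unfold studentT
  rw [hbase, hsqrt, neg_div, Real.div_rpow (by positivity) hs.le, Real.rpow_neg hs.le, hpow,
    mul_assoc (Real.Gamma (ν / 2)), ← mul_div_assoc ((ν * Real.pi) ^ _), hscale]
  field_simp

/-- For `0 < b ≤ 1` with `nb > k`, the normalized fractional marginal
posterior density of `β` is the multivariate Student `t` density
`t(β; β̂, s²(nb−k)⁻¹(XᵀX)⁻¹, nb−k)`. -/
theorem stmt_8 {n k : ℕ} (y : Fin n → ℝ) (X : Matrix (Fin n) (Fin k) ℝ)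
    (hX : IsUnit (Xᵀ * X))
    (hs2 : 0 < (y - X.mulVec ((Xᵀ * X)⁻¹.mulVec (Xᵀ.mulVec y))) ⬝ᵥ
      (y - X.mulVec ((Xᵀ * X)⁻¹.mulVec (Xᵀ.mulVec y))))
    (b : ℝ) (hb0 : 0 < b) (hb1 : b ≤ 1) (hnb : (k : ℝ) < n * b) (β : Fin k → ℝ) :
    let βhat := (Xᵀ * X)⁻¹.mulVec (Xᵀ.mulVec y)
    let s2 := (y - X.mulVec βhat) ⬝ᵥ (y - X.mulVec βhat)
    (∫ t in Set.Ioi (0 : ℝ),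
        (2 * Real.pi * t) ^ (-((n : ℝ) * b) / 2) *
          Real.exp (-(b * ((y - X.mulVec β) ⬝ᵥ (y - X.mulVec β))) / (2 * t)) * t⁻¹) /
      (∫ β' : Fin k → ℝ, ∫ t in Set.Ioi (0 : ℝ),
        (2 * Real.pi * t) ^ (-((n : ℝ) * b) / 2) *
          Real.exp (-(b * ((y - X.mulVec β') ⬝ᵥ (y - X.mulVec β'))) / (2 * t)) * t⁻¹) =
      studentT ((n : ℝ) * b - k) βhat ((s2 / ((n : ℝ) * b - k)) • (Xᵀ * X)⁻¹) β := by
  intro βhat s2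
  have hs2_pos : 0 < s2 := hs2
  have hA := posDef_transpose_mul_self_of_isUnit hX
  set A := Xᵀ * X
  have hk : (0 : ℝ) ≤ k := k.cast_nonneg
  have ha : 0 < (n : ℝ) * b / 2 := by linarith
  have hQ (v : Fin k → ℝ) : 0 ≤ v ⬝ᵥ A *ᵥ v := by
    simpa using hA.posSemidef.dotProduct_mulVec_nonneg v
  set C : ℝ := (2 * Real.pi) ^ (-((n : ℝ) * b / 2)) * Real.Gamma ((n : ℝ) * b / 2) *
    (b / 2) ^ (-((n : ℝ) * b / 2)) with hC
  have hC0 : 0 < C := by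
    have := Real.Gamma_pos_of_pos ha
    positivity
  have hinner (γ : Fin k → ℝ) : ∫ t in Set.Ioi (0 : ℝ),
        (2 * Real.pi * t) ^ (-((n : ℝ) * b) / 2) *
          Real.exp (-(b * ((y - X.mulVec γ) ⬝ᵥ (y - X.mulVec γ))) / (2 * t)) * t⁻¹ =
      C * (s2 + (γ - βhat) ⬝ᵥ A *ᵥ (γ - βhat)) ^ (-((n : ℝ) * b / 2)) := by
    have hpos : 0 < s2 + (γ - βhat) ⬝ᵥ A *ᵥ (γ - βhat) := by linarith [hQ (γ - βhat)]
    rw [sub_mulVec_dotProduct_self_eq hX y γ (βhat := βhat) rfl, hC, mul_assoc _ ((b / 2) ^ _),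
      ← Real.mul_rpow (by positivity) hpos.le,
      ← integral_rpow_mul_exp_neg_div_mul_inv ha (by positivity)]
    refine integral_congr_ae (.of_forall fun t => ?_)
    simp only [neg_div]
    congr 4
    change b * (s2 + _) / (2 * t) = b / 2 * (s2 + _) / t
    rw [← div_div]
    ring
  have hden : ∫ γ : Fin k → ℝ, (s2 + (γ - βhat) ⬝ᵥ A *ᵥ (γ - βhat)) ^ (-((n : ℝ) * b / 2)) =
      Real.pi ^ ((k : ℝ) / 2) * Real.Gamma ((n * b - k) / 2) * s2 ^ (-((n * b - k) / 2)) /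
        (Real.Gamma (n * b / 2) * √A.det) := by
    rw [integral_sub_right_eq_self (fun v => (s2 + v ⬝ᵥ A *ᵥ v) ^ (-((n : ℝ) * b / 2))),
      hA.integral_const_add_rpow_neg hs2_pos (by rw [Fintype.card_fin]; linarith), Fintype.card_fin,
      ← sub_div]
  simp only [hinner]
  rw [integral_const_mul, mul_div_mul_left _ _ hC0.ne', hden,
    studentT_eq hA (sub_pos.mpr hnb) hs2_pos, sub_add_cancel, Real.rpow_neg hs2_pos.le]
  have hΓ := (Real.Gamma_pos_of_pos ha).ne'
  have hΓ' := (Real.Gamma_pos_of_pos (half_pos (sub_pos.mpr hnb))).ne'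
  have hdet := (Real.sqrt_pos.mpr hA.det_pos).ne'
  change _ = _ * (s2 + _) ^ _
  field_simp
end

section
/- The marginal of a multivariate Student t density over a coordinate block is again a multivariate Student t density with the same degrees of freedom: for every x₁ ∈ ℝ^{d₁}, ∫_{ℝ^{d₂}} t((x₁, x₂); (m₁, m₂), S, ν) dx₂ = t(x₁; m₁, S₁₁, ν). -/
open Matrix MeasureTheory

theorem integral_exp_neg_mul_dotProduct_self_s9 {n : ℕ} {c : ℝ} (hc : 0 < c) :
    Integrable (fun z : Fin n → ℝ => Real.exp (-(c * (z ⬝ᵥ z)))) ∧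
    ∫ z : Fin n → ℝ, Real.exp (-(c * (z ⬝ᵥ z))) = (Real.pi / c) ^ ((n : ℝ) / 2) := by
  have key : (fun z : Fin n → ℝ => Real.exp (-(c * (z ⬝ᵥ z)))) =
      fun z => ∏ i, Real.exp (-c * z i ^ 2) := by
    funext z
    rw [← Real.exp_sum, dotProduct, Finset.mul_sum, ← Finset.sum_neg_distrib]
    congr 1
    exact Finset.sum_congr rfl fun i _ => by ring
  rw [key]
  refine ⟨Integrable.fintype_prod (f := fun _ x => Real.exp (-c * x ^ 2))
    fun _ => integrable_exp_neg_mul_sq hc, ?_⟩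
  rw [integral_fintype_prod_volume_eq_pow (fun x : ℝ => Real.exp (-c * x ^ 2)), integral_gaussian,
    Real.sqrt_eq_rpow, ← Real.rpow_natCast, ← Real.rpow_mul (by positivity), Fintype.card_fin]
  ring_nf

theorem integral_add_mul_dotProduct_self_rpow_neg {n : ℕ} {a b p : ℝ} (ha : 0 < a) (hb : 0 < b)
    (hp : (n : ℝ) / 2 < p) :
    ∫ z : Fin n → ℝ, (a + b * (z ⬝ᵥ z)) ^ (-p) =
      (Real.pi / b) ^ ((n : ℝ) / 2) * (Real.Gamma (p - n / 2) / Real.Gamma p) *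
        a ^ (-(p - n / 2)) := by
  have hp0 : 0 < p := lt_of_le_of_lt (by positivity) hp
  have hΓ := (Real.Gamma_pos_of_pos hp0).ne'
  have hq : 0 < p - n / 2 := sub_pos.2 hp
  have hnn (z : Fin n → ℝ) : 0 ≤ z ⬝ᵥ z :=
    Finset.sum_nonneg fun i _ => mul_self_nonneg _
  let F : (Fin n → ℝ) → ℝ → ℝ := fun z t =>
    t ^ (p - 1) * Real.exp (-((a + b * (z ⬝ᵥ z)) * t))
  have hFeq (z : Fin n → ℝ) (t : ℝ) :
      F z t = t ^ (p - 1) * Real.exp (-(a * t)) * Real.exp (-((t * b) * (z ⬝ᵥ z))) := by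
    simp only [F]
    rw [mul_assoc, ← Real.exp_add]
    ring_nf
  have hFint (t : ℝ) (ht : 0 < t) : ∫ z, F z t =
      (Real.pi / b) ^ ((n : ℝ) / 2) * (t ^ (p - n / 2 - 1) * Real.exp (-(a * t))) := by
    simp only [hFeq]
    rw [integral_const_mul, (integral_exp_neg_mul_dotProduct_self_s9 (mul_pos ht hb)).2,
      mul_comm t b, ← div_div, Real.div_rpow (by positivity) ht.le,
      show p - n / 2 - 1 = (p - 1) - n / 2 by ring, Real.rpow_sub ht (p - 1)]
    ring
  have hFpos (z : Fin n → ℝ) (t : ℝ) (ht : 0 < t) : 0 ≤ F z t := by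
    simp only [F]; positivity
  have hint : Integrable (Function.uncurry F)
      ((volume : Measure (Fin n → ℝ)).prod (volume.restrict (Set.Ioi (0 : ℝ)))) := by
    rw [integrable_prod_iff']
    · refine ⟨?_, ?_⟩
      · filter_upwards [ae_restrict_mem measurableSet_Ioi] with t ht
        simp only [Function.uncurry_apply_pair, hFeq]
        exact (integral_exp_neg_mul_dotProduct_self_s9 (mul_pos ht hb)).1.const_mul _
      · have h := (integrableOn_rpow_mul_exp_neg_mul_rpow (p := 1) (s := p - n / 2 - 1) (b := a)
          (by linarith) one_pos ha).const_mul ((Real.pi / b) ^ ((n : ℝ) / 2))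
        refine h.congr ?_
        filter_upwards [ae_restrict_mem measurableSet_Ioi] with t ht
        simp only [Function.uncurry_apply_pair]
        rw [integral_congr_ae (Filter.Eventually.of_forall fun z =>
          Real.norm_of_nonneg (hFpos z t ht)), hFint t ht]
        simp
    · apply Measurable.aestronglyMeasurable
      simp only [F, dotProduct]
      fun_prop
  have hG (z : Fin n → ℝ) : (a + b * (z ⬝ᵥ z)) ^ (-p) =
      (∫ t in Set.Ioi (0 : ℝ), F z t) / Real.Gamma p := by
    have hpos : 0 < a + b * (z ⬝ᵥ z) := by have := hnn z; positivity
    simp only [F]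
    rw [Real.integral_rpow_mul_exp_neg_mul_Ioi hp0 hpos, one_div, Real.inv_rpow hpos.le,
      Real.rpow_neg hpos.le, mul_div_cancel_right₀ _ hΓ]
  simp only [hG]
  rw [integral_div, integral_integral_swap hint,
    setIntegral_congr_fun measurableSet_Ioi (fun t ht => hFint t ht), integral_const_mul,
    Real.integral_rpow_mul_exp_neg_mul_Ioi hq ha, one_div, Real.inv_rpow ha.le,
    Real.rpow_neg ha.le]
  ring

theorem integral_comp_mulVec {n : ℕ} {B : Matrix (Fin n) (Fin n) ℝ} (hB : B.det ≠ 0)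
    (f : (Fin n → ℝ) → ℝ) :
    ∫ w, f (B *ᵥ w) = |B.det|⁻¹ * ∫ z, f z := by
  let e : (Fin n → ℝ) ≃ₗ[ℝ] (Fin n → ℝ) := LinearMap.equivOfDetNeZero (Matrix.toLin' B) (by simpa)
  have h := e.toContinuousLinearEquiv.toHomeomorph.measurableEmbedding.integral_map
    (μ := volume) f
  have h2 := Real.map_matrix_volume_pi_eq_smul_volume_pi hB
  have h3 : (e.toContinuousLinearEquiv.toHomeomorph : (Fin n → ℝ) → (Fin n → ℝ)) =
    Matrix.toLin' B := rfl
  rw [h3, h2, integral_smul_measure, ENNReal.toReal_ofReal (abs_nonneg _), abs_inv] at h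
  simpa using h.symm

open scoped MatrixOrder in
theorem integral_add_mul_quadForm_rpow_neg {n : ℕ} {R : Matrix (Fin n) (Fin n) ℝ} (hR : R.PosDef)
    {a b p : ℝ} (ha : 0 < a) (hb : 0 < b) (hp : (n : ℝ) / 2 < p) :
    ∫ w : Fin n → ℝ, (a + b * (w ⬝ᵥ R *ᵥ w)) ^ (-p) =
      (√R.det)⁻¹ * ((Real.pi / b) ^ ((n : ℝ) / 2) * (Real.Gamma (p - n / 2) / Real.Gamma p) *
        a ^ (-(p - n / 2))) := by
  obtain ⟨B, hB⟩ := CStarAlgebra.nonneg_iff_eq_star_mul_self.mp hR.posSemidef.nonneg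
  rw [star_eq_conjTranspose, conjTranspose_eq_transpose_of_trivial] at hB
  have hdet : R.det = B.det ^ 2 := by rw [hB, det_mul, det_transpose, sq]
  have hB0 : B.det ≠ 0 := fun h => hR.det_pos.ne' (by simp [hdet, h])
  have hquad (w : Fin n → ℝ) : w ⬝ᵥ R *ᵥ w = (B *ᵥ w) ⬝ᵥ (B *ᵥ w) := by
    rw [hB, ← mulVec_mulVec, dotProduct_mulVec, vecMul_transpose]
  simp only [hquad]
  rw [integral_comp_mulVec hB0 (fun z => (a + b * (z ⬝ᵥ z)) ^ (-p)),
    integral_add_mul_dotProduct_self_rpow_neg ha hb hp, hdet, Real.sqrt_sq_eq_abs]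

theorem Matrix.PosDef.exists_quadForm_inv_sum_elim {m n : Type*} [Fintype m] [Fintype n]
    [DecidableEq m] [DecidableEq n] {S : Matrix (m ⊕ n) (m ⊕ n) ℝ} (hS : S.PosDef) :
    ∃ (R : Matrix n n ℝ) (L : Matrix n m ℝ), R.PosDef ∧ S.det * R.det = S.toBlocks₁₁.det ∧
      ∀ x y, Sum.elim x y ⬝ᵥ S⁻¹ *ᵥ Sum.elim x y =
        x ⬝ᵥ S.toBlocks₁₁⁻¹ *ᵥ x + (L *ᵥ x + y) ⬝ᵥ R *ᵥ (L *ᵥ x + y) := by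
  have hK := hS.inv
  set K := S⁻¹ with hKdef
  have hR : K.toBlocks₂₂.PosDef := hK.submatrix Sum.inr_injective
  have hH : K.toBlocks₁₂ᴴ = K.toBlocks₂₁ := by
    ext i j
    exact hK.isHermitian.apply (Sum.inr i) (Sum.inl j)
  have hKb : fromBlocks K.toBlocks₁₁ K.toBlocks₁₂ K.toBlocks₁₂ᴴ K.toBlocks₂₂ = K := by
    rw [hH, fromBlocks_toBlocks]
  let := hR.isUnit.invertible
  let : Invertible (fromBlocks K.toBlocks₁₁ K.toBlocks₁₂ K.toBlocks₁₂ᴴ K.toBlocks₂₂) :=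
    (hKb.symm ▸ hK.isUnit : IsUnit _).invertible
  let := invertibleOfFromBlocks₂₂Invertible K.toBlocks₁₁ K.toBlocks₁₂ K.toBlocks₁₂ᴴ K.toBlocks₂₂
  have hinv := invOf_fromBlocks₂₂_eq K.toBlocks₁₁ K.toBlocks₁₂ K.toBlocks₁₂ᴴ K.toBlocks₂₂
  have hdet := det_fromBlocks₂₂ K.toBlocks₁₁ K.toBlocks₁₂ K.toBlocks₁₂ᴴ K.toBlocks₂₂
  have hSS : K⁻¹ = S := nonsing_inv_nonsing_inv S hS.det_pos.ne'.isUnit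
  rw [invOf_eq_nonsing_inv, hKb, hSS] at hinv
  have hA : S.toBlocks₁₁⁻¹ =
      K.toBlocks₁₁ - K.toBlocks₁₂ * K.toBlocks₂₂⁻¹ * K.toBlocks₁₂ᴴ := by
    rw [hinv, toBlocks_fromBlocks₁₁, ← invOf_eq_nonsing_inv (⅟_), invOf_invOf,
      invOf_eq_nonsing_inv]
  refine ⟨K.toBlocks₂₂, K.toBlocks₂₂⁻¹ * K.toBlocks₁₂ᴴ, hR, ?_, fun x y => ?_⟩
  · rw [hKb, invOf_eq_nonsing_inv, ← hA, hKdef, det_nonsing_inv, det_nonsing_inv,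
      Ring.inverse_eq_inv', ← hKdef] at hdet
    have h1 := hS.det_pos.ne'
    have h2 : S.toBlocks₁₁.det ≠ 0 :=
      (hS.submatrix Sum.inl_injective : S.toBlocks₁₁.PosDef).det_pos.ne'
    field_simp at hdet
    linarith
  · have h := schur_complement_eq₂₂ K.toBlocks₁₁ K.toBlocks₁₂ x y hR.isHermitian
    rw [hKb, ← hA] at h
    simp only [star_trivial, ← dotProduct_mulVec] at h
    rw [h, add_comm]

theorem Matrix.PosDef.exists_quadForm_inv_append {d₁ d₂ : ℕ}
    {S : Matrix (Fin (d₁ + d₂)) (Fin (d₁ + d₂)) ℝ} (hS : S.PosDef) :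
    ∃ (R : Matrix (Fin d₂) (Fin d₂) ℝ) (L : Matrix (Fin d₂) (Fin d₁) ℝ), R.PosDef ∧
      S.det * R.det = (S.submatrix (Fin.castAdd d₂) (Fin.castAdd d₂)).det ∧
      ∀ x y, Fin.append x y ⬝ᵥ S⁻¹ *ᵥ Fin.append x y =
        x ⬝ᵥ (S.submatrix (Fin.castAdd d₂) (Fin.castAdd d₂))⁻¹ *ᵥ x +
          (L *ᵥ x + y) ⬝ᵥ R *ᵥ (L *ᵥ x + y) := by
  obtain ⟨R, L, hR, hdet, hquad⟩ :=
    (hS.submatrix (e := finSumFinEquiv) finSumFinEquiv.injective).exists_quadForm_inv_sum_elim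
  have hA : (S.submatrix finSumFinEquiv finSumFinEquiv).toBlocks₁₁ =
      S.submatrix (Fin.castAdd d₂) (Fin.castAdd d₂) := by
    ext i j
    simp [toBlocks₁₁]
  rw [hA, det_submatrix_equiv_self] at hdet
  refine ⟨R, L, hR, hdet, fun x y => ?_⟩
  have hxy : Fin.append x y = Sum.elim x y ∘ finSumFinEquiv.symm := by
    rw [Equiv.eq_comp_symm]
    ext (i | i) <;> simp
  have h := hquad x y
  rw [hA] at h
  rw [← h, inv_submatrix_equiv, submatrix_mulVec_equiv, ← hxy, ← comp_equiv_symm_dotProduct, ← hxy]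

/-- The marginal of a multivariate Student `t` density over a
coordinate block is again a multivariate Student `t` density with the same degrees of
freedom: for every `x₁ ∈ ℝ^{d₁}`,
`∫_{ℝ^{d₂}} t((x₁,x₂); (m₁,m₂), S, ν) dx₂ = t(x₁; m₁, S₁₁, ν)`. -/
theorem stmt_9 {d₁ d₂ : ℕ} (h₁ : 1 ≤ d₁) (h₂ : 1 ≤ d₂) (ν : ℝ) (hν : 0 < ν)
    (m₁ : Fin d₁ → ℝ) (m₂ : Fin d₂ → ℝ)
    (S : Matrix (Fin (d₁ + d₂)) (Fin (d₁ + d₂)) ℝ) (hS : S.PosDef)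
    (x₁ : Fin d₁ → ℝ) :
    ∫ x₂ : Fin d₂ → ℝ,
        studentT ν (Fin.append m₁ m₂) S (Fin.append x₁ x₂) =
      studentT ν m₁ (S.submatrix (Fin.castAdd d₂) (Fin.castAdd d₂)) x₁ := by
  obtain ⟨R, L, hR, hdet, hquad⟩ := hS.exists_quadForm_inv_append
  have hA : (S.submatrix (Fin.castAdd d₂) (Fin.castAdd d₂)).PosDef :=
    hS.submatrix (Fin.castAdd_injective d₁ d₂)
  set A := S.submatrix (Fin.castAdd d₂) (Fin.castAdd d₂)
  have hsub (x₂ : Fin d₂ → ℝ) : Fin.append x₁ x₂ - Fin.append m₁ m₂ =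
      Fin.append (x₁ - m₁) (x₂ - m₂) := by
    ext i
    refine Fin.addCases (fun i => ?_) (fun i => ?_) i <;> simp
  set a := 1 + (x₁ - m₁) ⬝ᵥ A⁻¹ *ᵥ (x₁ - m₁) / ν with ha_def
  have ha : 0 < a := by
    have : 0 ≤ (x₁ - m₁) ⬝ᵥ A⁻¹ *ᵥ (x₁ - m₁) := by
      simpa using hA.inv.posSemidef.dotProduct_mulVec_nonneg (x₁ - m₁)
    positivity
  have hp : (d₂ : ℝ) / 2 < (ν + (d₁ + d₂ : ℕ)) / 2 := by
    push_cast
    linarith [(Nat.cast_nonneg d₁ : (0 : ℝ) ≤ d₁)]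
  have hker (x₂ : Fin d₂ → ℝ) :
      1 + Fin.append (x₁ - m₁) (x₂ - m₂) ⬝ᵥ S⁻¹ *ᵥ Fin.append (x₁ - m₁) (x₂ - m₂) / ν =
        a + ν⁻¹ * ((x₂ + (L *ᵥ (x₁ - m₁) - m₂)) ⬝ᵥ R *ᵥ (x₂ + (L *ᵥ (x₁ - m₁) - m₂))) := by
    rw [hquad, ha_def, show L *ᵥ (x₁ - m₁) + (x₂ - m₂) = x₂ + (L *ᵥ (x₁ - m₁) - m₂) by abel]
    ring
  simp only [studentT, hsub, hker, ← ha_def]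
  rw [integral_const_mul, integral_add_right_eq_self
      (fun w => (a + ν⁻¹ * (w ⬝ᵥ R *ᵥ w)) ^ (-(ν + (d₁ + d₂ : ℕ)) / 2)), neg_div,
    integral_add_mul_quadForm_rpow_neg hR ha (inv_pos.2 hν) hp, ← hdet, Real.sqrt_mul hS.det_pos.le,
    show (ν + (d₁ + d₂ : ℕ)) / 2 - (d₂ : ℝ) / 2 = (ν + d₁) / 2 by push_cast; ring,
    div_inv_eq_mul, mul_comm Real.pi ν, neg_div,
    show ((d₁ + d₂ : ℕ) : ℝ) / 2 = (d₁ : ℝ) / 2 + d₂ / 2 by push_cast; ring,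
    Real.rpow_add (by positivity)]
  have hΓ : Real.Gamma ((ν + (d₁ + d₂ : ℕ)) / 2) ≠ 0 := (Real.Gamma_pos_of_pos (by positivity)).ne'
  have hπ : (ν * Real.pi) ^ ((d₂ : ℝ) / 2) ≠ 0 := by positivity
  field_simp
end

section
/- The conditional of a multivariate Student t density is again a multivariate Student t density: for all x₁ ∈ ℝ^{d₁} and x₂ ∈ ℝ^{d₂}, t((x₁, x₂); (m₁, m₂), S, ν) = t(x₁; m₁, S₁₁, ν) · t(x₂; m₂ + S₂₁S₁₁⁻¹(x₁ − m₁), ((ν + Q₁)/(ν + d₁))·(S₂₂ − S₂₁S₁₁⁻¹S₁₂), ν + d₁), where Q₁ = (x₁ − m₁)ᵀ S₁₁⁻¹ (x₁ − m₁). -/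
open Matrix MeasureTheory

/-- The quadratic form of the inverse of a symmetric block matrix, split along the Schur complement
of its upper left block. -/
theorem dotProduct_fromBlocks_inv_mulVec {m n : Type*} [Fintype m] [Fintype n] [DecidableEq m]
    [DecidableEq n] (A : Matrix m m ℝ) (B : Matrix m n ℝ) (C : Matrix n m ℝ) (D : Matrix n n ℝ)
    (hA : IsUnit A.det) (hSchur : IsUnit (D - C * A⁻¹ * B).det) (hAt : Aᵀ = A) (hBC : Bᵀ = C)
    (u : m → ℝ) (v : n → ℝ) :
    Sum.elim u v ⬝ᵥ (fromBlocks A B C D)⁻¹ *ᵥ Sum.elim u v =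
      u ⬝ᵥ A⁻¹ *ᵥ u +
        (v - (C * A⁻¹) *ᵥ u) ⬝ᵥ (D - C * A⁻¹ * B)⁻¹ *ᵥ (v - (C * A⁻¹) *ᵥ u) := by
  let := A.invertibleOfIsUnitDet hA
  have hdet : IsUnit (fromBlocks A B C D).det := by
    rw [det_fromBlocks₁₁, invOf_eq_nonsing_inv]
    exact hA.mul hSchur
  set w := v - (C * A⁻¹) *ᵥ u with hw
  set y := (D - C * A⁻¹ * B)⁻¹ *ᵥ w with hy
  have hDy : D *ᵥ y = w + (C * A⁻¹ * B) *ᵥ y := by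
    rw [← sub_eq_iff_eq_add, ← sub_mulVec, hy, mulVec_mulVec, mul_nonsing_inv _ hSchur, one_mulVec]
  have hsolve : fromBlocks A B C D *ᵥ Sum.elim (A⁻¹ *ᵥ (u - B *ᵥ y)) y = Sum.elim u v := by
    rw [fromBlocks_mulVec, Sum.elim_comp_inl, Sum.elim_comp_inr]
    congr 1
    · rw [mulVec_mulVec, mul_nonsing_inv _ hA, one_mulVec, sub_add_cancel]
    · rw [hDy, hw]
      simp only [mulVec_sub, mulVec_mulVec, Matrix.mul_assoc]
      abel
  have hinv : (fromBlocks A B C D)⁻¹ *ᵥ Sum.elim u v = Sum.elim (A⁻¹ *ᵥ (u - B *ᵥ y)) y := by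
    rw [← hsolve, mulVec_mulVec, nonsing_inv_mul _ hdet, one_mulVec]
  have hcross : (C * A⁻¹) *ᵥ u ⬝ᵥ y = u ⬝ᵥ (A⁻¹ * B) *ᵥ y := by
    rw [dotProduct_mulVec u, ← mulVec_transpose, transpose_mul, transpose_nonsing_inv, hAt, hBC]
  rw [hinv, sumElim_dotProduct_sumElim, mulVec_sub, dotProduct_sub, mulVec_mulVec, hw,
    sub_dotProduct, hcross]
  ring

/-- The factorization of the Student `t` density as an identity between real numbers: `q₁` and `q₂`
stand for the two quadratic forms, `a` and `b` for the determinants of the upper left block and of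
its Schur complement. -/
theorem studentT_scalar_identity (n₁ n₂ : ℕ) {ν q₁ q₂ a b : ℝ} (hν : 0 < ν) (hq₁ : 0 ≤ q₁)
    (hq : 0 ≤ q₁ + q₂) (ha : 0 < a) (hb : 0 < b) :
    Real.Gamma ((ν + (n₁ + n₂ : ℕ)) / 2) /
          (Real.Gamma (ν / 2) * (ν * Real.pi) ^ (((n₁ + n₂ : ℕ) : ℝ) / 2) * √(a * b)) *
        (1 + (q₁ + q₂) / ν) ^ (-(ν + (n₁ + n₂ : ℕ)) / 2) =
      Real.Gamma ((ν + n₁) / 2) /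
            (Real.Gamma (ν / 2) * (ν * Real.pi) ^ ((n₁ : ℝ) / 2) * √a) *
          (1 + q₁ / ν) ^ (-(ν + n₁) / 2) *
        (Real.Gamma ((ν + n₁ + n₂) / 2) /
            (Real.Gamma ((ν + n₁) / 2) * ((ν + n₁) * Real.pi) ^ ((n₂ : ℝ) / 2) *
              √(((ν + q₁) / (ν + n₁)) ^ n₂ * b)) *
          (1 + ((ν + q₁) / (ν + n₁))⁻¹ * q₂ / (ν + n₁)) ^ (-(ν + n₁ + n₂) / 2)) := by
  have hνn : 0 < ν + n₁ := by positivity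
  have hνq : 0 < ν + q₁ := by positivity
  have hπ := Real.pi_pos
  have hr : 0 < 1 + q₁ / ν := by positivity
  have hratio : 1 + ((ν + q₁) / (ν + n₁))⁻¹ * q₂ / (ν + n₁) =
      (1 + (q₁ + q₂) / ν) / (1 + q₁ / ν) := by
    field_simp
    ring
  have hsqrt : √(((ν + q₁) / (ν + n₁)) ^ n₂) = ((ν + q₁) / (ν + n₁)) ^ ((n₂ : ℝ) / 2) := by
    rw [Real.sqrt_eq_rpow, ← Real.rpow_natCast_mul (by positivity), mul_one_div]
  have hscale : ((ν + n₁) * Real.pi) ^ ((n₂ : ℝ) / 2) *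
      ((ν + q₁) / (ν + n₁)) ^ ((n₂ : ℝ) / 2) =
      (ν * Real.pi) ^ ((n₂ : ℝ) / 2) * (1 + q₁ / ν) ^ ((n₂ : ℝ) / 2) := by
    rw [← Real.mul_rpow (by positivity) (by positivity),
      ← Real.mul_rpow (by positivity) (by positivity)]
    congr 1
    field_simp
  have hpow : (1 + q₁ / ν) ^ (-(ν + n₁) / 2) =
      (1 + q₁ / ν) ^ ((n₂ : ℝ) / 2) * (1 + q₁ / ν) ^ (-(ν + n₁ + n₂) / 2) := by
    rw [← Real.rpow_add hr]
    congr 1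
    ring
  have hπpow : (ν * Real.pi) ^ (((n₁ + n₂ : ℕ) : ℝ) / 2) =
      (ν * Real.pi) ^ ((n₁ : ℝ) / 2) * (ν * Real.pi) ^ ((n₂ : ℝ) / 2) := by
    rw [← Real.rpow_add (by positivity)]
    congr 1
    push_cast
    ring
  have hden : Real.Gamma ((ν + n₁) / 2) * ((ν + n₁) * Real.pi) ^ ((n₂ : ℝ) / 2) *
      √(((ν + q₁) / (ν + n₁)) ^ n₂ * b) =
      Real.Gamma ((ν + n₁) / 2) *
        ((ν * Real.pi) ^ ((n₂ : ℝ) / 2) * (1 + q₁ / ν) ^ ((n₂ : ℝ) / 2)) * √b := by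
    rw [Real.sqrt_mul (by positivity), hsqrt, ← hscale]
    ring
  have hcast : ν + ((n₁ + n₂ : ℕ) : ℝ) = ν + n₁ + n₂ := by
    push_cast
    ring
  rw [hden, hratio, Real.div_rpow (by positivity) hr.le, hpow, hπpow, hcast, Real.sqrt_mul ha.le]
  have hΓ : 0 < Real.Gamma ((ν + n₁) / 2) := Real.Gamma_pos_of_pos (by positivity)
  have hΓν : 0 < Real.Gamma (ν / 2) := Real.Gamma_pos_of_pos (by positivity)
  have h₁ : 0 < (ν * Real.pi) ^ ((n₁ : ℝ) / 2) := by positivity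
  have h₂ : 0 < (ν * Real.pi) ^ ((n₂ : ℝ) / 2) := by positivity
  have h₃ : 0 < (1 + q₁ / ν) ^ ((n₂ : ℝ) / 2) := Real.rpow_pos_of_pos hr _
  have h₄ : 0 < (1 + q₁ / ν) ^ (-(ν + n₁ + n₂) / 2) := Real.rpow_pos_of_pos hr _
  generalize (1 + q₁ / ν) ^ ((n₂ : ℝ) / 2) = e₃ at *
  generalize (1 + q₁ / ν) ^ (-(ν + n₁ + n₂) / 2) = e₄ at *
  generalize (1 + (q₁ + q₂) / ν) ^ (-(ν + n₁ + n₂) / 2) = e₅ at *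
  generalize (ν * Real.pi) ^ ((n₁ : ℝ) / 2) = e₁ at *
  generalize (ν * Real.pi) ^ ((n₂ : ℝ) / 2) = e₂ at *
  have hsa : 0 < √a := by positivity
  have hsb : 0 < √b := by positivity
  field_simp

/-- The conditional of a multivariate Student `t` density is again a
multivariate Student `t` density:
`t((x₁,x₂); (m₁,m₂), S, ν) = t(x₁; m₁, S₁₁, ν) ·
  t(x₂; m₂ + S₂₁S₁₁⁻¹(x₁−m₁), ((ν+Q₁)/(ν+d₁))·(S₂₂ − S₂₁S₁₁⁻¹S₁₂), ν+d₁)`,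
where `Q₁ = (x₁−m₁)ᵀS₁₁⁻¹(x₁−m₁)`. -/
theorem stmt_10 {d₁ d₂ : ℕ} (h₁ : 1 ≤ d₁) (h₂ : 1 ≤ d₂) (ν : ℝ) (hν : 0 < ν)
    (m₁ : Fin d₁ → ℝ) (m₂ : Fin d₂ → ℝ)
    (S : Matrix (Fin (d₁ + d₂)) (Fin (d₁ + d₂)) ℝ) (hS : S.PosDef)
    (x₁ : Fin d₁ → ℝ) (x₂ : Fin d₂ → ℝ) :
    let S11 := S.submatrix (Fin.castAdd d₂) (Fin.castAdd d₂)
    let S12 := S.submatrix (Fin.castAdd d₂) (Fin.natAdd d₁)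
    let S21 := S.submatrix (Fin.natAdd d₁) (Fin.castAdd d₂)
    let S22 := S.submatrix (Fin.natAdd d₁) (Fin.natAdd d₁)
    let Q1 := (x₁ - m₁) ⬝ᵥ S11⁻¹.mulVec (x₁ - m₁)
    studentT ν (Fin.append m₁ m₂) S (Fin.append x₁ x₂) =
      studentT ν m₁ S11 x₁ *
        studentT (ν + d₁) (m₂ + (S21 * S11⁻¹).mulVec (x₁ - m₁))
          (((ν + Q1) / (ν + d₁)) • (S22 - S21 * S11⁻¹ * S12)) x₂ := by
  intro S11 S12 S21 S22 Q1
  have hA : S11.PosDef := hS.submatrix (Fin.castAdd_injective d₁ d₂)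
  have hAdet : 0 < S11.det := hA.det_pos
  have hAt : S11ᵀ = S11 := hA.isHermitian
  have hBC : S12ᵀ = S21 := by
    have hSt : Sᵀ = S := hS.isHermitian
    ext i j
    exact congr_fun₂ hSt _ _
  have hblock : S.submatrix finSumFinEquiv finSumFinEquiv = fromBlocks S11 S12 S21 S22 := by
    ext (i | i) (j | j) <;> rfl
  have hdet : S.det = S11.det * (S22 - S21 * S11⁻¹ * S12).det := by
    let := S11.invertibleOfIsUnitDet hAdet.ne'.isUnit
    rw [← det_submatrix_equiv_self finSumFinEquiv, hblock, det_fromBlocks₁₁, invOf_eq_nonsing_inv]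
  have hSchur : 0 < (S22 - S21 * S11⁻¹ * S12).det :=
    (mul_pos_iff_of_pos_left hAdet).1 (hdet ▸ hS.det_pos)
  have hsub : (Fin.append x₁ x₂ - Fin.append m₁ m₂) ∘ finSumFinEquiv =
      Sum.elim (x₁ - m₁) (x₂ - m₂) := by
    ext (i | i) <;> simp
  have hform : (Fin.append x₁ x₂ - Fin.append m₁ m₂) ⬝ᵥ
      S⁻¹ *ᵥ (Fin.append x₁ x₂ - Fin.append m₁ m₂) =
      Q1 + (x₂ - (m₂ + (S21 * S11⁻¹) *ᵥ (x₁ - m₁))) ⬝ᵥ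
        (S22 - S21 * S11⁻¹ * S12)⁻¹ *ᵥ (x₂ - (m₂ + (S21 * S11⁻¹) *ᵥ (x₁ - m₁))) := by
    rw [← sub_sub, ← dotProduct_fromBlocks_inv_mulVec S11 S12 S21 S22 hAdet.ne'.isUnit
      hSchur.ne'.isUnit hAt hBC, ← hblock, ← hsub, inv_submatrix_equiv, submatrix_mulVec_equiv,
      Function.comp_assoc, Equiv.self_comp_symm, Function.comp_id, comp_equiv_dotProduct_comp_equiv]
  have hQ1 : 0 ≤ Q1 := hA.inv.posSemidef.dotProduct_mulVec_nonneg (x₁ - m₁)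
  have hQ : 0 ≤ (Fin.append x₁ x₂ - Fin.append m₁ m₂) ⬝ᵥ
      S⁻¹ *ᵥ (Fin.append x₁ x₂ - Fin.append m₁ m₂) :=
    hS.inv.posSemidef.dotProduct_mulVec_nonneg _
  have hc : (ν + Q1) / (ν + d₁) ≠ 0 := by positivity
  have hinv : (((ν + Q1) / (ν + d₁)) • (S22 - S21 * S11⁻¹ * S12))⁻¹ =
      ((ν + Q1) / (ν + d₁))⁻¹ • (S22 - S21 * S11⁻¹ * S12)⁻¹ :=
    inv_smul' _ (Units.mk0 _ hc) hSchur.ne'.isUnit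
  rw [hform] at hQ
  unfold studentT
  rw [hform, hdet, hinv, det_smul, Fintype.card_fin, smul_mulVec, dotProduct_smul, smul_eq_mul]
  exact studentT_scalar_identity d₁ d₂ hν hQ1 hQ hAdet hSchur
end

section
/- The default Bayes factor of an equality-constrained hypothesis does not depend on the choice of the complement matrix D: if D and D' are two real (k − q_E) × k matrices, each of full row rank k − q_E and each satisfying D R_Eᵀ = 0 and D' R_Eᵀ = 0, with corresponding stacked matrices T and T', then for all ξ_E, ξ_E' ∈ ℝ^{q_E} and all c, c' > 0 with nc > k and nc' > k, m_T(ξ_E, c)/m_T(ξ_E', c') = m_{T'}(ξ_E, c)/m_{T'}(ξ_E', c'), where m_T(ξ_E, c) = ∫_{ℝ^{k−q_E}} ∫₀^∞ (2πσ²)^{−nc/2} exp(−c‖y − X T⁻¹(ξ_E, ξ_I)‖²/(2σ²)) (σ²)⁻¹ dσ² dξ_I. -/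
open Matrix MeasureTheory

/-- The vector `(ξ_E, ξ_I) ∈ ℝ^{q_E} × ℝ^{k−q_E}` stacked into `ℝ^k`. -/
def stackVec {k qE : ℕ} (hq : qE ≤ k) (ξE : Fin qE → ℝ) (ξI : Fin (k - qE) → ℝ) :
    Fin k → ℝ := fun i =>
  Sum.elim ξE ξI ((finSumFinEquiv.trans (finCongr (Nat.add_sub_cancel' hq))).symm i)

/-- The `k × k` matrix `T` obtained by stacking `R_E` on top of `D`. -/
def stackMat {k qE : ℕ} (hq : qE ≤ k) (RE : Matrix (Fin qE) (Fin k) ℝ)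
    (D : Matrix (Fin (k - qE)) (Fin k) ℝ) : Matrix (Fin k) (Fin k) ℝ :=
  (Matrix.fromRows RE D).submatrix
    (finSumFinEquiv.trans (finCongr (Nat.add_sub_cancel' hq))).symm id

/-- `∫₀^∞ (2πσ²)^{−nc/2} exp(−c·q/(2σ²)) (σ²)⁻¹ dσ²`. -/
noncomputable def fracInt (n : ℕ) (c q : ℝ) : ℝ :=
  ∫ t in Set.Ioi (0 : ℝ),
    (2 * Real.pi * t) ^ (-((n : ℝ) * c) / 2) * Real.exp (-(c * q) / (2 * t)) * t⁻¹

/-- The OLS estimate `β̂ = (XᵀX)⁻¹Xᵀy`. -/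
noncomputable def betaHat {n k : ℕ} (y : Fin n → ℝ) (X : Matrix (Fin n) (Fin k) ℝ) :
    Fin k → ℝ := (Xᵀ * X)⁻¹.mulVec (Xᵀ.mulVec y)

/-- The sum of squares `s² = ‖y − Xβ̂‖²`. -/
noncomputable def sSq {n k : ℕ} (y : Fin n → ℝ) (X : Matrix (Fin n) (Fin k) ℝ) : ℝ :=
  (y - X.mulVec (betaHat y X)) ⬝ᵥ (y - X.mulVec (betaHat y X))

/-- Equality-constrained fractional marginal likelihood `m_T(ξ_E, c)` computed with the
complement matrix `D`. -/
noncomputable def mT {n k qE : ℕ} (hq : qE ≤ k) (y : Fin n → ℝ)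
    (X : Matrix (Fin n) (Fin k) ℝ) (RE : Matrix (Fin qE) (Fin k) ℝ)
    (D : Matrix (Fin (k - qE)) (Fin k) ℝ) (ξE : Fin qE → ℝ) (c : ℝ) : ℝ :=
  ∫ ξI : Fin (k - qE) → ℝ,
    fracInt n c
      ((y - X.mulVec ((stackMat hq RE D)⁻¹.mulVec (stackVec hq ξE ξI))) ⬝ᵥ
        (y - X.mulVec ((stackMat hq RE D)⁻¹.mulVec (stackVec hq ξE ξI))))

theorem isUnit_of_rank_eq {m : ℕ} (M : Matrix (Fin m) (Fin m) ℝ) (h : M.rank = m) :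
    IsUnit M := by
  rw [← Matrix.linearIndependent_rows_iff_isUnit, linearIndependent_iff_card_eq_finrank_span,
    Fintype.card_fin, Set.finrank, ← Matrix.rank_eq_finrank_span_row, h]

theorem isUnit_mul_transpose_of_rank_eq {m k : ℕ} (M : Matrix (Fin m) (Fin k) ℝ)
    (h : M.rank = m) : IsUnit (M * Mᵀ) :=
  isUnit_of_rank_eq _ (by rw [Matrix.rank_self_mul_transpose, h])

theorem stackMat_mulVec {k qE : ℕ} (hq : qE ≤ k) (RE : Matrix (Fin qE) (Fin k) ℝ)
    (D : Matrix (Fin (k - qE)) (Fin k) ℝ) (v : Fin k → ℝ) :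
    stackMat hq RE D *ᵥ v = stackVec hq (RE *ᵥ v) (D *ᵥ v) := by
  ext i
  simp only [stackMat, stackVec, Matrix.mulVec, dotProduct, Matrix.submatrix_apply, id]
  cases (finSumFinEquiv.trans (finCongr (Nat.add_sub_cancel' hq))).symm i <;> simp [Matrix.mulVec, dotProduct]

theorem stackVec_inj {k qE : ℕ} (hq : qE ≤ k) {a b : Fin qE → ℝ} {u w : Fin (k - qE) → ℝ} :
    stackVec hq a u = stackVec hq b w ↔ a = b ∧ u = w := by
  refine ⟨fun h => ⟨?_, ?_⟩, fun h => by rw [h.1, h.2]⟩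
  · ext i
    simpa [stackVec] using congrFun h
      ((finSumFinEquiv.trans (finCongr (Nat.add_sub_cancel' hq))) (Sum.inl i))
  · ext i
    simpa [stackVec] using congrFun h
      ((finSumFinEquiv.trans (finCongr (Nat.add_sub_cancel' hq))) (Sum.inr i))

theorem isUnit_stackMat {k qE : ℕ} (hq : qE ≤ k) (RE : Matrix (Fin qE) (Fin k) ℝ)
    (D : Matrix (Fin (k - qE)) (Fin k) ℝ) (hRE : RE.rank = qE) (hD : D.rank = k - qE)
    (hDRE : D * REᵀ = 0) : IsUnit (stackMat hq RE D) := by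
  have hRD : RE * Dᵀ = 0 := by
    rw [← Matrix.transpose_transpose RE, ← Matrix.transpose_mul, hDRE, Matrix.transpose_zero]
  have hT : IsUnit (stackMat hq RE D * (stackMat hq RE D)ᵀ) := by
    rw [stackMat, Matrix.transpose_submatrix, ← Matrix.submatrix_mul _ _ _ id _ Function.bijective_id,
      Matrix.isUnit_submatrix_equiv, Matrix.transpose_fromRows, Matrix.fromRows_mul_fromCols,
      hDRE, hRD, Matrix.isUnit_fromBlocks_zero₁₂]
    exact ⟨isUnit_mul_transpose_of_rank_eq RE hRE, isUnit_mul_transpose_of_rank_eq D hD⟩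
  rw [Matrix.isUnit_iff_isUnit_det] at hT ⊢
  rw [Matrix.det_mul] at hT
  exact isUnit_of_mul_isUnit_left hT

/-- Two complements of `RE` of full row rank differ by an invertible change of basis. -/
theorem exists_det_ne_zero_eq_mul {k qE : ℕ} (hq : qE ≤ k) (RE : Matrix (Fin qE) (Fin k) ℝ)
    (D D' : Matrix (Fin (k - qE)) (Fin k) ℝ) (hRE : RE.rank = qE) (hD : D.rank = k - qE)
    (hD' : D'.rank = k - qE) (hDRE : D * REᵀ = 0) (hD'RE : D' * REᵀ = 0) :
    ∃ A : Matrix (Fin (k - qE)) (Fin (k - qE)) ℝ, A.det ≠ 0 ∧ D' = A * D := by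
  have hDD := (Matrix.isUnit_iff_isUnit_det _).1 (isUnit_mul_transpose_of_rank_eq D hD)
  have hT := isUnit_stackMat hq RE D hRE hD hDRE
  have hA : D' = D' * Dᵀ * (D * Dᵀ)⁻¹ * D := by
    rw [← sub_eq_zero]
    set E := D' - D' * Dᵀ * (D * Dᵀ)⁻¹ * D with hE
    have hER : RE * Eᵀ = 0 := by
      rw [← Matrix.transpose_transpose RE, ← Matrix.transpose_mul, hE, Matrix.sub_mul,
        Matrix.mul_assoc _ D, hDRE, hD'RE]
      simp
    have hED : D * Eᵀ = 0 := by
      rw [← Matrix.transpose_transpose D, ← Matrix.transpose_mul, hE, Matrix.sub_mul,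
        Matrix.mul_assoc _ D, Matrix.nonsing_inv_mul_cancel_right _ _ hDD]
      simp
    rw [← Matrix.transpose_eq_zero]
    have hTE : stackMat hq RE D * Eᵀ = 0 := by
      rw [stackMat, ← Matrix.submatrix_id_id Eᵀ, ← Matrix.submatrix_mul _ _ _ id _ Function.bijective_id,
        Matrix.fromRows_mul, hER, hED]
      ext i j
      rw [Matrix.submatrix_apply]
      cases (finSumFinEquiv.trans (finCongr (Nat.add_sub_cancel' hq))).symm i <;> simp
    rw [← Matrix.nonsing_inv_mul_cancel_left _ Eᵀ ((Matrix.isUnit_iff_isUnit_det _).1 hT), hTE,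
      Matrix.mul_zero]
  refine ⟨_, fun h0 => ?_, hA⟩
  have h1 := (Matrix.isUnit_iff_isUnit_det _).1 (isUnit_mul_transpose_of_rank_eq D' hD')
  rw [hA, Matrix.mul_assoc, Matrix.det_mul, h0, zero_mul] at h1
  exact not_isUnit_zero h1

theorem inv_stackMat_mulVec_mul {k qE : ℕ} (hq : qE ≤ k) (RE : Matrix (Fin qE) (Fin k) ℝ)
    (D : Matrix (Fin (k - qE)) (Fin k) ℝ) (A : Matrix (Fin (k - qE)) (Fin (k - qE)) ℝ)
    (hT : IsUnit (stackMat hq RE D)) (hT' : IsUnit (stackMat hq RE (A * D)))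
    (ξE : Fin qE → ℝ) (η : Fin (k - qE) → ℝ) :
    (stackMat hq RE (A * D))⁻¹ *ᵥ stackVec hq ξE (A *ᵥ η) =
      (stackMat hq RE D)⁻¹ *ᵥ stackVec hq ξE η := by
  rw [Matrix.isUnit_iff_isUnit_det] at hT hT'
  set v := (stackMat hq RE D)⁻¹ *ᵥ stackVec hq ξE η with hv
  have h : stackMat hq RE D *ᵥ v = stackVec hq ξE η := by
    rw [hv, Matrix.mulVec_mulVec, Matrix.mul_nonsing_inv _ hT, Matrix.one_mulVec]
  rw [stackMat_mulVec, stackVec_inj] at h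
  have h' : stackMat hq RE (A * D) *ᵥ v = stackVec hq ξE (A *ᵥ η) := by
    rw [stackMat_mulVec, ← Matrix.mulVec_mulVec, h.1, h.2]
  rw [← h', Matrix.mulVec_mulVec, Matrix.nonsing_inv_mul _ hT', Matrix.one_mulVec]

theorem integral_comp_mulVec_s12 {m : ℕ} (A : Matrix (Fin m) (Fin m) ℝ) (hA : A.det ≠ 0)
    (f : (Fin m → ℝ) → ℝ) : ∫ x, f (A *ᵥ x) = |A.det⁻¹| * ∫ x, f x := by
  have hdet : LinearMap.det (Matrix.toLin' A) ≠ 0 := by rwa [LinearMap.det_toLin']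
  have hemb : MeasurableEmbedding (Matrix.toLin' A) :=
    (LinearMap.equivOfDetNeZero (Matrix.toLin' A)
      hdet).toContinuousLinearEquiv.toHomeomorph.measurableEmbedding
  have h := hemb.integral_map (μ := volume) f
  rw [Real.map_matrix_volume_pi_eq_smul_volume_pi hA, integral_smul_measure,
    ENNReal.toReal_ofReal (abs_nonneg _), smul_eq_mul] at h
  simpa using h.symm

theorem mT_mul {n k qE : ℕ} (hq : qE ≤ k) (y : Fin n → ℝ) (X : Matrix (Fin n) (Fin k) ℝ)
    (RE : Matrix (Fin qE) (Fin k) ℝ) (D : Matrix (Fin (k - qE)) (Fin k) ℝ)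
    (A : Matrix (Fin (k - qE)) (Fin (k - qE)) ℝ) (hA : A.det ≠ 0)
    (hT : IsUnit (stackMat hq RE D)) (hT' : IsUnit (stackMat hq RE (A * D)))
    (ξE : Fin qE → ℝ) (c : ℝ) :
    mT hq y X RE D ξE c = |A.det⁻¹| * mT hq y X RE (A * D) ξE c := by
  unfold mT
  rw [← integral_comp_mulVec_s12 A hA]
  simp only [inv_stackMat_mulVec_mul hq RE D A hT hT']

/-- The default Bayes factor of an equality-constrained hypothesis does
not depend on the choice of the complement matrix `D`: for two valid complement matrices
`D`, `D'`, the ratios `m_T(ξ_E,c)/m_T(ξ_E',c')` agree. -/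
theorem stmt_12 {n k qE : ℕ} (hnk : k < n) (hq : qE ≤ k)
    (y : Fin n → ℝ) (X : Matrix (Fin n) (Fin k) ℝ) (hX : IsUnit (Xᵀ * X))
    (hs2 : 0 < sSq y X)
    (RE : Matrix (Fin qE) (Fin k) ℝ) (hRE : RE.rank = qE)
    (D D' : Matrix (Fin (k - qE)) (Fin k) ℝ)
    (hD : D.rank = k - qE) (hD' : D'.rank = k - qE)
    (hDRE : D * REᵀ = 0) (hD'RE : D' * REᵀ = 0)
    (ξE ξE' : Fin qE → ℝ) (c c' : ℝ) (hc : 0 < c) (hc' : 0 < c')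
    (hnc : (k : ℝ) < n * c) (hnc' : (k : ℝ) < n * c') :
    mT hq y X RE D ξE c / mT hq y X RE D ξE' c' =
      mT hq y X RE D' ξE c / mT hq y X RE D' ξE' c' := by
  obtain ⟨A, hA, rfl⟩ := exists_det_ne_zero_eq_mul hq RE D D' hRE hD hD' hDRE hD'RE
  have hT := isUnit_stackMat hq RE D hRE hD hDRE
  have hT' := isUnit_stackMat hq RE (A * D) hRE hD' hD'RE
  rw [mT_mul hq y X RE D A hA hT hT', mT_mul hq y X RE D A hA hT hT',
    mul_div_mul_left _ _ (abs_ne_zero.2 (inv_ne_zero hA))]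
end
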